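/- arXiv:0805.3767 — 2 statements merged into one kernel-verified Lean document; each statement's English description precedes it below -/
import Mathlib

section
/- Let 0 < δ < 1/4, set C = 1/(1−2δ), and let (j,n) ∈ P with |j| > 8δC². Fix an admissible integer L with |j| ≤ L ≤ 2(|j|−1) and the square Λ_j. Let u⁰ : Λ_j → ℂ be the indicator function of (j,n) and E⁰ = 0. Then there exist a sequence (E^k)_{k≥0} of reals starting from E⁰ and a sequence (u^k)_{k≥0} of functions Λ_j → ℂ starting from u⁰, with u^k(j,n) = 1 for all k, such that for every k ≥ 0: ((H_{Λ_j} − E^k)u^{k+1})(x) = 0 for all x ∈ Λ_j ∖ {(j,n)} and ((H_{Λ_j} − E^{k+1})u^{k+1})((j,n)) = 0; moreover, writing F^k = (H_{Λ_j} − E^k)u^k (so that ‖F⁰‖₂ = 2δ), for every k ≥ 1 one has ‖F^k‖₂ ≤ (2C²‖F⁰‖₂/|j|)·‖F^{k−1}‖₂ < (1/2)‖F^{k−1}‖₂ and |E^k − E^{k−1}| ≤ (C/|j|)·‖F^{k−1}‖₂. -/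
noncomputable section

/-- The finite-volume Floquet Hamiltonian `H_S` on a finite set `S ⊆ ℤ × ℤ`:
diagonal entries `n + j²`, entries `δ` between `(j,n)` and `(j',n')` with
`|j−j'| = 1` and `|n−n'| = 1`, all other entries `0`. -/
def Hmat (δ : ℝ) (S : Finset (ℤ × ℤ)) : Matrix S S ℝ := fun x y =>
  if (x : ℤ × ℤ) = (y : ℤ × ℤ) then (((x : ℤ × ℤ).2 + (x : ℤ × ℤ).1 ^ 2 : ℤ) : ℝ)
  else if |(x : ℤ × ℤ).1 - (y : ℤ × ℤ).1| = 1 ∧ |(x : ℤ × ℤ).2 - (y : ℤ × ℤ).2| = 1 then δ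
  else 0

/-- `μ` is an eigenvalue of the real symmetric matrix `H_S`. -/
def IsEigen (δ : ℝ) (S : Finset (ℤ × ℤ)) (μ : ℝ) : Prop :=
  ∃ v : S → ℝ, v ≠ 0 ∧ (Hmat δ S).mulVec v = μ • v

/-- The square `Λ_j` of side `2L` centered at `(j, n)`. -/
def sqΛ (j n L : ℤ) : Finset (ℤ × ℤ) :=
  Finset.Icc (j - L) (j + L) ×ˢ Finset.Icc (n - L) (n + L)

/-- ℓ² norm of a function on a finite set. -/
def norm2 {S : Finset (ℤ × ℤ)} (f : S → ℂ) : ℝ := Real.sqrt (∑ x : S, ‖f x‖ ^ 2)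

/-- The `ℓ²` norm of a real function on a finite type. -/
def l2 {ι : Type*} [Fintype ι] (f : ι → ℝ) : ℝ := ‖WithLp.toLp 2 f‖

section EuclideanNorm

variable {ι : Type*} [Fintype ι]

lemma l2_nonneg (f : ι → ℝ) : 0 ≤ l2 f := norm_nonneg _

lemma l2_sq (f : ι → ℝ) : l2 f ^ 2 = ∑ x, f x ^ 2 := by
  simp [l2, EuclideanSpace.norm_sq_eq]

lemma l2_sq_eq_dotProduct (f : ι → ℝ) : l2 f ^ 2 = f ⬝ᵥ f := by
  rw [l2_sq]
  simp [dotProduct, sq]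

lemma abs_dotProduct_le (f g : ι → ℝ) : |f ⬝ᵥ g| ≤ l2 f * l2 g := by
  refine abs_le_of_sq_le_sq ?_ (mul_nonneg (l2_nonneg f) (l2_nonneg g))
  rw [mul_pow, l2_sq, l2_sq]
  exact Finset.sum_mul_sq_le_sq_mul_sq _ _ _

lemma l2_add_le (f g : ι → ℝ) : l2 (f + g) ≤ l2 f + l2 g := by
  simpa [l2] using norm_add_le (WithLp.toLp 2 f) (WithLp.toLp 2 g)

lemma l2_smul (c : ℝ) (f : ι → ℝ) : l2 (c • f) = |c| * l2 f := by
  simpa [l2] using norm_smul c (WithLp.toLp 2 f)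

lemma l2_neg (f : ι → ℝ) : l2 (-f) = l2 f := by
  simp [l2]

lemma l2_sub_le (f g : ι → ℝ) : l2 (f - g) ≤ l2 f + l2 g := by
  simpa [l2] using norm_sub_le (WithLp.toLp 2 f) (WithLp.toLp 2 g)

lemma l2_eq_zero {f : ι → ℝ} : l2 f = 0 ↔ f = 0 := by
  simp [l2]

lemma l2_pos {f : ι → ℝ} (hf : f ≠ 0) : 0 < l2 f :=
  (l2_nonneg f).lt_of_ne fun h => hf (l2_eq_zero.1 h.symm)

end EuclideanNorm

section Coercivity

variable {ι : Type*} [Fintype ι]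

/-- Schur's test for a nonnegative symmetric matrix with row sums at most `4`. -/
lemma l2_mulVec_le {B : Matrix ι ι ℝ} (hB : B.IsSymm) (hB0 : ∀ x y, 0 ≤ B x y)
    (hrow : ∀ x, ∑ y, B x y ≤ 4) (f : ι → ℝ) : l2 (B.mulVec f) ≤ 4 * l2 f := by
  set g := B.mulVec f with hg
  have hcol : ∀ y, ∑ x, B x y ≤ 4 := fun y => by
    simpa only [hB.apply] using hrow y
  have h1 : ∑ x, g x ^ 2 = ∑ x, ∑ y, B x y * (g x * f y) := by
    refine Finset.sum_congr rfl fun x _ => ?_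
    rw [sq]
    nth_rewrite 2 [hg]
    rw [Matrix.mulVec, dotProduct, Finset.mul_sum]
    exact Finset.sum_congr rfl fun y _ => by ring
  have h2 : ∑ x, ∑ y, B x y * (g x * f y)
      ≤ ∑ x, ∑ y, (B x y * (g x ^ 2 / 8) + B x y * (2 * f y ^ 2)) := by
    refine Finset.sum_le_sum fun x _ => Finset.sum_le_sum fun y _ => ?_
    rw [← mul_add]
    exact mul_le_mul_of_nonneg_left (by nlinarith [sq_nonneg (g x / 4 - f y)]) (hB0 x y)
  have h3 : ∑ x, ∑ y, B x y * (g x ^ 2 / 8) ≤ ∑ x, g x ^ 2 / 2 := by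
    refine Finset.sum_le_sum fun x _ => ?_
    rw [← Finset.sum_mul]
    nlinarith [hrow x, sq_nonneg (g x)]
  have h4 : ∑ x, ∑ y, B x y * (2 * f y ^ 2) ≤ ∑ y, 8 * f y ^ 2 := by
    rw [Finset.sum_comm]
    refine Finset.sum_le_sum fun y _ => ?_
    rw [← Finset.sum_mul]
    nlinarith [hcol y, sq_nonneg (f y)]
  simp only [Finset.sum_add_distrib] at h2
  rw [← Finset.sum_div] at h3
  rw [← Finset.mul_sum] at h4
  refine le_of_sq_le_sq ?_ (by positivity [l2_nonneg f])
  rw [mul_pow, l2_sq, l2_sq]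
  linarith

variable [DecidableEq ι]

/-- Coercivity of a diagonally dominant symmetric matrix, where only the off-diagonal entries
joining diagonal entries of equal sign have to be dominated. -/
lemma mul_l2_le_l2_mulVec {D : ι → ℝ} {B : Matrix ι ι ℝ} (hB : B.IsSymm)
    (hB0 : ∀ x y, 0 ≤ B x y) {c : ℝ}
    (hrow : ∀ x, c + ∑ y, (if (0 < D x ↔ 0 < D y) then B x y else 0) ≤ |D x|) (f : ι → ℝ) :
    c * l2 f ≤ l2 ((Matrix.diagonal D + B).mulVec f) := by
  set σ : ι → ℝ := fun x => if 0 < D x then 1 else -1 with hσ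
  set R : ι → ι → ℝ := fun x y => if (0 < D x ↔ 0 < D y) then B x y else 0 with hR
  have hRsymm : ∀ x y, R x y = R y x := fun x y => by
    simp only [hR, iff_comm (a := 0 < D x), hB.apply x y]
  have hσD : ∀ x, σ x * D x = |D x| := fun x => by
    simp only [hσ]
    split_ifs with h
    · rw [abs_of_pos h, one_mul]
    · rw [abs_of_nonpos (not_lt.1 h)]; ring
  have hσl2 : l2 (fun x => σ x * f x) = l2 f := by
    have : l2 (fun x => σ x * f x) ^ 2 = l2 f ^ 2 := by
      rw [l2_sq, l2_sq]
      refine Finset.sum_congr rfl fun x _ => ?_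
      simp only [hσ]
      split_ifs <;> ring
    exact (pow_left_inj₀ (l2_nonneg _) (l2_nonneg _) two_ne_zero).1 this
  have hcs := (le_abs_self _).trans
    (abs_dotProduct_le (fun x => σ x * f x) ((Matrix.diagonal D + B).mulVec f))
  have hexp : (fun x => σ x * f x) ⬝ᵥ ((Matrix.diagonal D + B).mulVec f)
      = ∑ x, |D x| * f x ^ 2 + ∑ x, ∑ y, σ x * B x y * (f x * f y) := by
    rw [dotProduct, ← Finset.sum_add_distrib]
    refine Finset.sum_congr rfl fun x _ => ?_
    rw [Matrix.add_mulVec, Pi.add_apply, Matrix.mulVec_diagonal, mul_add, Matrix.mulVec,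
      dotProduct, Finset.mul_sum, ← hσD x]
    congr 1
    · ring
    · exact Finset.sum_congr rfl fun y _ => by ring
  have hswap : ∑ x, ∑ y, σ x * B x y * (f x * f y) = ∑ x, ∑ y, σ y * B x y * (f x * f y) := by
    rw [Finset.sum_comm]
    refine Finset.sum_congr rfl fun x _ => Finset.sum_congr rfl fun y _ => ?_
    rw [hB.apply x y]; ring
  have hlow : -∑ x, ∑ y, (R x y * f x ^ 2 + R x y * f y ^ 2)
      ≤ ∑ x, ∑ y, σ x * B x y * (f x * f y) + ∑ x, ∑ y, σ y * B x y * (f x * f y) := by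
    simp only [← Finset.sum_add_distrib, ← Finset.sum_neg_distrib]
    refine Finset.sum_le_sum fun x _ => Finset.sum_le_sum fun y _ => ?_
    have := hB0 x y
    simp only [hσ, hR]
    by_cases hx : 0 < D x <;> by_cases hy : 0 < D y <;> simp only [hx, hy, if_true, if_false,
      true_iff, iff_true] <;>
      nlinarith [mul_nonneg this (sq_nonneg (f x + f y)), mul_nonneg this (sq_nonneg (f x - f y))]
  have hRsum : ∑ x, ∑ y, R x y * f y ^ 2 = ∑ x, ∑ y, R x y * f x ^ 2 := by
    rw [Finset.sum_comm]
    exact Finset.sum_congr rfl fun x _ => Finset.sum_congr rfl fun y _ => by rw [hRsymm]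
  simp only [Finset.sum_add_distrib, hRsum, ← hswap] at hlow
  have hdom : c * ∑ x, f x ^ 2 + ∑ x, ∑ y, R x y * f x ^ 2 ≤ ∑ x, |D x| * f x ^ 2 := by
    rw [Finset.mul_sum, ← Finset.sum_add_distrib]
    refine Finset.sum_le_sum fun x _ => ?_
    rw [← Finset.sum_mul, ← add_mul]
    exact mul_le_mul_of_nonneg_right (hrow x) (sq_nonneg _)
  rw [hexp, hσl2] at hcs
  rw [← l2_sq] at hdom
  rcases (l2_nonneg f).eq_or_lt with h0 | h0
  · rw [← h0, mul_zero]; exact l2_nonneg _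
  · refine le_of_mul_le_mul_left ?_ h0
    nlinarith

end Coercivity
section Newton

variable {ι : Type*} [Fintype ι] [DecidableEq ι]

/-- The reduced Newton scheme attached to a matrix `M`, a coupling vector `b` and `δ`: the pair
consists of the approximate eigenvalue and of the approximate eigenvector away from the
resonant site. -/
def newtonIter (M : Matrix ι ι ℝ) (b : ι → ℝ) (δ : ℝ) : ℕ → ℝ × (ι → ℝ)
  | 0 => (0, 0)
  | k + 1 =>
    let v := (M - (newtonIter M b δ k).1 • (1 : Matrix ι ι ℝ))⁻¹.mulVec (-δ • b)
    (δ * (b ⬝ᵥ v), v)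

/-- The analytic hypotheses under which the reduced Newton scheme converges: `D` is the diagonal
part and `δ • B` the hopping part away from the resonant site, `b` is the coupling
to the resonant site, `p = D⁻¹ b`, and `J` is the size of `D` next to the resonant site. -/
structure NewtonData (D : ι → ℝ) (B : Matrix ι ι ℝ) (b p : ι → ℝ) (δ C J : ℝ) : Prop where
  δ_pos : 0 < δ
  δ_lt : δ < 1 / 4
  C_eq : C * (1 - 2 * δ) = 1
  lt_J : 8 * δ * C ^ 2 < J
  two_le_J : 2 ≤ J
  symm : B.IsSymm
  coercive : ∀ f, l2 f ≤ C * l2 ((Matrix.diagonal D + δ • B).mulVec f)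
  schur : ∀ f, l2 (B.mulVec f) ≤ 4 * l2 f
  diag_mul : ∀ x, D x * p x = b x
  l2_b : l2 b = 2
  l2_p : l2 p ≤ 2 / J
  b_p : b ⬝ᵥ p = -1 / (J ^ 2 - 1)
  p_B_p : p ⬝ᵥ B.mulVec p = 0
  l2_B_p : l2 (B.mulVec p) ^ 2 ≤ 4 / (J ^ 2 - 1)

namespace NewtonData

variable {D : ι → ℝ} {B : Matrix ι ι ℝ} {b p : ι → ℝ} {δ C J : ℝ}

lemma one_lt_C (h : NewtonData D B b p δ C J) : 1 < C := by
  nlinarith [h.C_eq, h.δ_pos, h.δ_lt]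

lemma C_lt_two (h : NewtonData D B b p δ C J) : C < 2 := by
  nlinarith [h.C_eq, h.δ_pos, h.δ_lt, h.one_lt_C]

lemma shift_mulVec (M : Matrix ι ι ℝ) (E : ℝ) (f : ι → ℝ) :
    (M - E • (1 : Matrix ι ι ℝ)).mulVec f = M.mulVec f - E • f := by
  rw [Matrix.sub_mulVec, Matrix.smul_mulVec, Matrix.one_mulVec]

lemma l2_le_of_shift (h : NewtonData D B b p δ C J) {E : ℝ} (hE : C * |E| ≤ δ) (f : ι → ℝ) :
    l2 f ≤ 4 / 3 * C * l2 ((Matrix.diagonal D + δ • B).mulVec f - E • f) := by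
  have h1 := h.coercive f
  have h2 := l2_add_le ((Matrix.diagonal D + δ • B).mulVec f - E • f) (E • f)
  rw [sub_add_cancel, l2_smul] at h2
  have h3 := h.one_lt_C
  have h4 := h.δ_lt
  have h5 := l2_nonneg f
  nlinarith [mul_le_mul_of_nonneg_left h2 (by linarith : 0 ≤ C),
    mul_le_mul_of_nonneg_right hE h5, mul_le_mul_of_nonneg_right h4.le h5]

lemma solve (h : NewtonData D B b p δ C J) {E : ℝ} (hE : C * |E| ≤ δ) (g : ι → ℝ) :
    let v := (Matrix.diagonal D + δ • B - E • (1 : Matrix ι ι ℝ))⁻¹.mulVec g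
    (Matrix.diagonal D + δ • B).mulVec v - E • v = g := by
  intro v
  have hinj : Function.Injective
      (Matrix.diagonal D + δ • B - E • (1 : Matrix ι ι ℝ)).mulVec := by
    intro f f' hff
    have h1 := h.l2_le_of_shift hE (f - f')
    rw [← shift_mulVec, Matrix.mulVec_sub, sub_eq_zero.2 hff] at h1
    have h2 : l2 (0 : ι → ℝ) = 0 := l2_eq_zero.2 rfl
    rw [h2, mul_zero] at h1
    exact sub_eq_zero.1 (l2_eq_zero.1 (h1.antisymm (l2_nonneg _)))
  have hunit := (Matrix.isUnit_iff_isUnit_det _).1 (Matrix.mulVec_injective_iff_isUnit.1 hinj)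
  rw [← shift_mulVec, Matrix.mulVec_mulVec, Matrix.mul_nonsing_inv _ hunit, Matrix.one_mulVec]

lemma diagonal_mulVec_p (h : NewtonData D B b p δ C J) : (Matrix.diagonal D).mulVec p = b := by
  ext x
  rw [Matrix.mulVec_diagonal, h.diag_mul]

/-- The remainder after subtracting the leading term `-δ • p` from the solution. -/
lemma shift_add_p (h : NewtonData D B b p δ C J) {E : ℝ} {v : ι → ℝ}
    (hv : (Matrix.diagonal D + δ • B).mulVec v - E • v = -δ • b) :
    (Matrix.diagonal D + δ • B).mulVec (v + δ • p) - E • (v + δ • p)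
      = δ • (δ • B.mulVec p - E • p) := by
  have hp : (Matrix.diagonal D + δ • B).mulVec p = b + δ • B.mulVec p := by
    rw [Matrix.add_mulVec, h.diagonal_mulVec_p, Matrix.smul_mulVec]
  rw [Matrix.mulVec_add, Matrix.mulVec_smul, hp]
  ext x
  have := congrFun hv x
  simp only [Pi.sub_apply, Pi.add_apply, Pi.smul_apply, smul_eq_mul] at this ⊢
  linear_combination this

lemma l2_solution_le (h : NewtonData D B b p δ C J) {E : ℝ} (hE : C * |E| ≤ δ) {v : ι → ℝ}
    (hv : (Matrix.diagonal D + δ • B).mulVec v - E • v = -δ • b) :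
    J * l2 v ≤ 4 * δ * C := by
  have hδ := h.δ_pos
  have hδ' := h.δ_lt
  have hC := h.one_lt_C
  have hC' := h.C_eq
  have hJ := h.two_le_J
  have hp0 := l2_nonneg p
  have hp : J * l2 p ≤ 2 := by
    have := h.l2_p
    rwa [le_div_iff₀ (by linarith), mul_comm] at this
  have h1 := h.l2_le_of_shift hE (v + δ • p)
  rw [h.shift_add_p hv, l2_smul, abs_of_pos hδ] at h1
  have h2 := l2_sub_le (δ • B.mulVec p) (E • p)
  rw [l2_smul, l2_smul, abs_of_pos hδ] at h2
  have h3 := h.schur p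
  have h4 := l2_sub_le (v + δ • p) (δ • p)
  rw [add_sub_cancel_right, l2_smul, abs_of_pos hδ] at h4
  have h5 : C * l2 (δ • B.mulVec p - E • p) ≤ (4 * δ * C + δ) * l2 p := by
    have := mul_le_mul_of_nonneg_right hE hp0
    nlinarith [mul_le_mul_of_nonneg_left h2 (by linarith : 0 ≤ C),
      mul_le_mul_of_nonneg_left h3 (by positivity : 0 ≤ C * δ)]
  have h6 : l2 v ≤ δ * (1 + 4 / 3 * (4 * δ * C + δ)) * l2 p := by
    nlinarith [mul_le_mul_of_nonneg_left h5 hδ.le]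
  have h7 : 1 + 4 / 3 * (4 * δ * C + δ) ≤ 2 * C := by
    have h8 : 0 ≤ (1 / 4 - δ) * (2 - 4 * δ) := by
      apply mul_nonneg <;> linarith
    have h9 : 1 + 4 / 3 * (4 * δ * C + δ)
        = C * ((1 - 2 * δ) * (1 + 4 / 3 * δ) + 16 / 3 * δ) := by
      linear_combination (-1 - 4 / 3 * δ) * hC'
    rw [h9, mul_comm 2 C]
    refine mul_le_mul_of_nonneg_left ?_ (by linarith)
    nlinarith
  calc J * l2 v ≤ J * (δ * (1 + 4 / 3 * (4 * δ * C + δ)) * l2 p) :=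
        mul_le_mul_of_nonneg_left h6 (by linarith)
    _ = δ * (1 + 4 / 3 * (4 * δ * C + δ)) * (J * l2 p) := by ring
    _ ≤ δ * (2 * C) * 2 := by gcongr
    _ = 4 * δ * C := by ring

/-- The first-order eigenvalue correction does not vanish. -/
lemma dotProduct_solution_ne_zero (h : NewtonData D B b p δ C J) {v : ι → ℝ}
    (hv : (Matrix.diagonal D + δ • B).mulVec v = -δ • b) : b ⬝ᵥ v ≠ 0 := by
  have hδ := h.δ_pos
  have hδ' := h.δ_lt
  have hC := h.one_lt_C
  have hC' := h.C_lt_two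
  have hJ := h.two_le_J
  set r := v + δ • p with hr
  have hMr : (Matrix.diagonal D + δ • B).mulVec r = (δ * δ) • B.mulVec p := by
    have := h.shift_add_p (E := 0) (v := v) (by rw [zero_smul, sub_zero, hv])
    rwa [zero_smul, zero_smul, sub_zero, sub_zero, smul_smul] at this
  have hbr : b ⬝ᵥ r = -δ * (B.mulVec p ⬝ᵥ r) := by
    have h1 : b ⬝ᵥ r = p ⬝ᵥ (Matrix.diagonal D).mulVec r := by
      refine Finset.sum_congr rfl fun x _ => ?_
      rw [Matrix.mulVec_diagonal, ← h.diag_mul]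
      ring
    have h2 : (Matrix.diagonal D).mulVec r = (δ * δ) • B.mulVec p - δ • B.mulVec r := by
      rw [← hMr, Matrix.add_mulVec, Matrix.smul_mulVec, add_sub_cancel_right]
    have h3 : p ⬝ᵥ B.mulVec r = B.mulVec p ⬝ᵥ r := by
      rw [Matrix.dotProduct_mulVec, ← Matrix.mulVec_transpose, h.symm.eq]
    rw [h1, h2, dotProduct_sub, dotProduct_smul, dotProduct_smul, h.p_B_p, h3]
    simp
  have hbv : b ⬝ᵥ v = δ * (1 / (J ^ 2 - 1)) - δ * (B.mulVec p ⬝ᵥ r) := by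
    have : v = r - δ • p := by rw [hr, add_sub_cancel_right]
    rw [this, dotProduct_sub, hbr, dotProduct_smul, h.b_p, smul_eq_mul]
    ring
  have hrle : l2 r ≤ C * (δ * δ * l2 (B.mulVec p)) := by
    have := h.coercive r
    rwa [hMr, l2_smul, abs_of_pos (mul_pos hδ hδ)] at this
  have hle : B.mulVec p ⬝ᵥ r ≤ C * δ * δ * (4 * (1 / (J ^ 2 - 1))) := by
    calc B.mulVec p ⬝ᵥ r ≤ l2 (B.mulVec p) * l2 r := (le_abs_self _).trans (abs_dotProduct_le _ _)
      _ ≤ l2 (B.mulVec p) * (C * (δ * δ * l2 (B.mulVec p))) :=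
        mul_le_mul_of_nonneg_left hrle (l2_nonneg _)
      _ = C * δ * δ * l2 (B.mulVec p) ^ 2 := by ring
      _ ≤ C * δ * δ * (4 / (J ^ 2 - 1)) :=
        mul_le_mul_of_nonneg_left h.l2_B_p (by positivity)
      _ = _ := by ring
  have hm : 0 < 1 / (J ^ 2 - 1) := one_div_pos.2 (by nlinarith)
  have hsmall : C * δ * δ * 4 < 1 := by
    have : δ * δ < 1 / 16 := by nlinarith
    nlinarith [mul_pos hδ hδ]
  have : 0 < b ⬝ᵥ v := by
    rw [hbv, ← mul_sub]
    refine mul_pos hδ ?_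
    nlinarith
  exact this.ne'

/-- The approximate eigenvalues and eigenvectors. -/
lemma newtonIter_spec (h : NewtonData D B b p δ C J) (k : ℕ) :
    let E := fun k => (newtonIter (Matrix.diagonal D + δ • B) b δ k).1
    let v := fun k => (newtonIter (Matrix.diagonal D + δ • B) b δ k).2
    C * |E k| ≤ δ ∧ E k = δ * (b ⬝ᵥ v k) ∧
      (Matrix.diagonal D + δ • B).mulVec (v (k + 1)) - E k • v (k + 1) = -δ • b := by
  intro E v
  have hEv : ∀ k, E k = δ * (b ⬝ᵥ v k) := by
    rintro (_ | k)
    · simp [E, v, newtonIter]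
    · rfl
  have hsolve : ∀ k, C * |E k| ≤ δ →
      (Matrix.diagonal D + δ • B).mulVec (v (k + 1)) - E k • v (k + 1) = -δ • b :=
    fun k hk => h.solve hk _
  suffices hE : ∀ k, C * |E k| ≤ δ from ⟨hE k, hEv k, hsolve k (hE k)⟩
  intro k
  induction k with
  | zero => simpa [E, newtonIter] using h.δ_pos.le
  | succ k ih =>
    have hδ := h.δ_pos
    have hC := h.one_lt_C
    have hJ := h.two_le_J
    have hv := h.l2_solution_le ih (hsolve k ih)
    have h1 := abs_dotProduct_le b (v (k + 1))
    rw [h.l2_b] at h1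
    rw [hEv, abs_mul, abs_of_pos hδ]
    have h2 : J * (C * (δ * |b ⬝ᵥ v (k + 1)|)) ≤ J * δ := by
      calc J * (C * (δ * |b ⬝ᵥ v (k + 1)|)) ≤ J * (C * (δ * (2 * l2 (v (k + 1))))) := by gcongr
        _ = 2 * C * δ * (J * l2 (v (k + 1))) := by ring
        _ ≤ 2 * C * δ * (4 * δ * C) := by gcongr
        _ = (8 * δ * C ^ 2) * δ := by ring
        _ ≤ J * δ := mul_le_mul_of_nonneg_right h.lt_J.le hδ.le
    exact le_of_mul_le_mul_left h2 (by linarith)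

/-- Existence of the reduced Newton iterates, with the estimates on the residuals. -/
lemma exists_iterates (h : NewtonData D B b p δ C J) :
    ∃ (E : ℕ → ℝ) (v F : ℕ → ι → ℝ), E 0 = 0 ∧ v 0 = 0 ∧
      (∀ k, F k = (Matrix.diagonal D + δ • B).mulVec (v k) - E k • v k + δ • b) ∧
      (∀ k, C * |E k| ≤ δ) ∧ (∀ k, E k = δ * (b ⬝ᵥ v k)) ∧
      (∀ k, (Matrix.diagonal D + δ • B).mulVec (v (k + 1)) - E k • v (k + 1) = -δ • b) ∧
      l2 (F 0) = 2 * δ ∧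
      ∀ k, l2 (F (k + 1)) ≤ (2 * C ^ 2 * l2 (F 0) / J) * l2 (F k) ∧
        l2 (F (k + 1)) < 1 / 2 * l2 (F k) ∧ |E (k + 1) - E k| ≤ C / J * l2 (F k) := by
  have hδ := h.δ_pos
  have hδ' := h.δ_lt
  have hC := h.one_lt_C
  have hJ := h.two_le_J
  set M := Matrix.diagonal D + δ • B with hM
  obtain ⟨E, v, hE0, hv0, hspec⟩ : ∃ (E : ℕ → ℝ) (v : ℕ → ι → ℝ), E 0 = 0 ∧ v 0 = 0 ∧
      ∀ k, C * |E k| ≤ δ ∧ E k = δ * (b ⬝ᵥ v k) ∧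
        M.mulVec (v (k + 1)) - E k • v (k + 1) = -δ • b :=
    ⟨_, _, rfl, rfl, h.newtonIter_spec⟩
  have hE := fun k => (hspec k).1
  have hEv := fun k => (hspec k).2.1
  have hv := fun k => (hspec k).2.2
  set F : ℕ → ι → ℝ := fun k => M.mulVec (v k) - E k • v k + δ • b with hF
  have hF0 : F 0 = δ • b := by simp [hF, hE0, hv0]
  have hl2F0 : l2 (F 0) = 2 * δ := by
    rw [hF0, l2_smul, abs_of_pos hδ, h.l2_b, mul_comm]
  have hFs : ∀ k, F (k + 1) = (E k - E (k + 1)) • v (k + 1) := fun k => by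
    ext x
    have := congrFun (hv k) x
    simp only [hF, Pi.sub_apply, Pi.add_apply, Pi.smul_apply, smul_eq_mul] at this ⊢
    linear_combination this
  have hstep : ∀ k, M.mulVec (v (k + 1) - v k) - E k • (v (k + 1) - v k) = -F k := fun k => by
    ext x
    have := congrFun (hv k) x
    simp only [hF, Matrix.mulVec_sub, Pi.neg_apply, Pi.sub_apply, Pi.add_apply, Pi.smul_apply,
      smul_eq_mul] at this ⊢
    linear_combination this
  have hMsymm : ∀ f g, f ⬝ᵥ M.mulVec g = M.mulVec f ⬝ᵥ g := fun f g => by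
    have : M.IsSymm := (Matrix.isSymm_diagonal D).add (h.symm.smul δ)
    rw [Matrix.dotProduct_mulVec, ← Matrix.mulVec_transpose, this.eq]
  have hEdiff : ∀ k, E (k + 1) - E k = v (k + 1) ⬝ᵥ F k := fun k => by
    have h1 : v (k + 1) ⬝ᵥ F k
        = -((M.mulVec (v (k + 1)) - E k • v (k + 1)) ⬝ᵥ (v (k + 1) - v k)) := by
      rw [← neg_neg (F k), ← hstep k, dotProduct_neg, dotProduct_sub, hMsymm, dotProduct_smul,
        sub_dotProduct, smul_dotProduct]
    rw [h1, hv k, smul_dotProduct, dotProduct_sub, hEv, hEv k, smul_eq_mul]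
    ring
  have hvle : ∀ k, J * l2 (v (k + 1)) ≤ 4 * δ * C := fun k => h.l2_solution_le (hE k) (hv k)
  have hEle : ∀ k, |E (k + 1) - E k| ≤ l2 (v (k + 1)) * l2 (F k) := fun k => by
    rw [hEdiff]; exact abs_dotProduct_le _ _
  have hvle' : ∀ k, l2 (v (k + 1)) ≤ C / J := fun k => by
    rw [le_div_iff₀ (by linarith), mul_comm]
    nlinarith [hvle k]
  have hne : ∀ k, F k ≠ 0 := by
    have hb : b ≠ 0 := fun hb => by
      have := h.l2_b
      rw [l2_eq_zero.2 hb] at this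
      norm_num at this
    intro k
    induction k with
    | zero => rw [hF0]; exact smul_ne_zero hδ.ne' hb
    | succ k ih =>
      have hbv : v (k + 1) ≠ 0 := fun h0 => by
        have := hv k
        rw [h0, Matrix.mulVec_zero, smul_zero, sub_zero] at this
        exact smul_ne_zero (neg_ne_zero.2 hδ.ne') hb this.symm
      rw [hFs]
      refine smul_ne_zero ?_ hbv
      rw [← neg_ne_zero, neg_sub]
      rcases k with _ | k
      · rw [hE0, sub_zero, hEv]
        refine mul_ne_zero hδ.ne' (h.dotProduct_solution_ne_zero ?_)
        simpa [hE0] using hv 0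
      · rw [hFs] at ih
        obtain ⟨hEne, hvne⟩ := smul_ne_zero_iff.1 ih
        rw [hEdiff, hFs, dotProduct_smul]
        refine smul_ne_zero hEne ?_
        have hpos := l2_pos hvne
        set t := v (k + 1 + 1) - v (k + 1) with ht
        have h1 := h.l2_le_of_shift (hE (k + 1)) t
        rw [← hM, hstep (k + 1), l2_neg, hFs, l2_smul] at h1
        have h2 : C * |E k - E (k + 1)| ≤ 2 * δ := by
          have := abs_sub (E k) (E (k + 1))
          nlinarith [hE k, hE (k + 1)]
        have h3 : l2 t < l2 (v (k + 1)) := by nlinarith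
        have h4 : v (k + 1 + 1) ⬝ᵥ v (k + 1) = l2 (v (k + 1)) ^ 2 + t ⬝ᵥ v (k + 1) := by
          rw [l2_sq_eq_dotProduct, ← add_dotProduct, ht, add_sub_cancel]
        have h5 := neg_le_of_abs_le (abs_dotProduct_le t (v (k + 1)))
        have : 0 < v (k + 1 + 1) ⬝ᵥ v (k + 1) := by rw [h4]; nlinarith
        exact this.ne'
  have hmain : ∀ k, l2 (F (k + 1)) ≤ (2 * C ^ 2 * l2 (F 0) / J) * l2 (F k) := fun k => by
    have hFk := l2_nonneg (F k)
    have hvk := l2_nonneg (v (k + 1))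
    have h1 : l2 (F (k + 1)) ≤ l2 (v (k + 1)) * l2 (v (k + 1)) * l2 (F k) := by
      rw [hFs, l2_smul, abs_sub_comm]
      nlinarith [mul_le_mul_of_nonneg_right (hEle k) hvk]
    refine h1.trans (mul_le_mul_of_nonneg_right ?_ hFk)
    rw [hl2F0, le_div_iff₀ (by linarith)]
    calc l2 (v (k + 1)) * l2 (v (k + 1)) * J
        = l2 (v (k + 1)) * (J * l2 (v (k + 1))) := by ring
      _ ≤ C / J * (4 * δ * C) := mul_le_mul (hvle' k) (hvle k) (by positivity) (by positivity)
      _ ≤ C / 1 * (4 * δ * C) := by gcongr; linarith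
      _ = 2 * C ^ 2 * (2 * δ) := by ring
  refine ⟨E, v, F, hE0, hv0, fun k => rfl, hE, hEv, hv, hl2F0, fun k => ⟨hmain k, ?_, ?_⟩⟩
  · refine (hmain k).trans_lt (mul_lt_mul_of_pos_right ?_ (l2_pos (hne k)))
    rw [hl2F0, div_lt_iff₀ (by linarith)]
    nlinarith [h.lt_J]
  · exact (hEle k).trans (mul_le_mul_of_nonneg_right (hvle' k) (l2_nonneg _))

end NewtonData

end Newton
section Lattice

/-- The hopping kernel on `ℤ × ℤ`. -/
def hop (x y : ℤ × ℤ) : ℝ := if |x.1 - y.1| = 1 ∧ |x.2 - y.2| = 1 then 1 else 0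

/-- The four lattice points joined to `x` by the hopping kernel. -/
def nbrs (x : ℤ × ℤ) : Finset (ℤ × ℤ) :=
  {(x.1 + 1, x.2 + 1), (x.1 + 1, x.2 - 1), (x.1 - 1, x.2 + 1), (x.1 - 1, x.2 - 1)}

/-- The unperturbed energy `n + j²` at the site `(j, n)`. -/
def energy (x : ℤ × ℤ) : ℤ := x.2 + x.1 ^ 2

lemma hop_comm (x y : ℤ × ℤ) : hop x y = hop y x := by
  simp only [hop, abs_sub_comm]

lemma hop_self (x : ℤ × ℤ) : hop x x = 0 := by
  simp [hop]

lemma hop_mul_self (x y : ℤ × ℤ) : hop x y * hop x y = hop x y := by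
  unfold hop; split_ifs <;> norm_num

lemma hop_nonneg (x y : ℤ × ℤ) : 0 ≤ hop x y := by
  unfold hop; split_ifs <;> norm_num

lemma mem_nbrs {x y : ℤ × ℤ} : y ∈ nbrs x ↔ |x.1 - y.1| = 1 ∧ |x.2 - y.2| = 1 := by
  obtain ⟨a, b⟩ := x
  obtain ⟨c, d⟩ := y
  simp only [nbrs, Finset.mem_insert, Finset.mem_singleton, Prod.mk.injEq,
    abs_eq (zero_le_one' ℤ)]
  omega

lemma hop_eq (x y : ℤ × ℤ) : hop x y = if y ∈ nbrs x then 1 else 0 := by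
  simp only [hop, mem_nbrs]

lemma sum_hop_mul {S : Finset (ℤ × ℤ)} {x : ℤ × ℤ} (hx : nbrs x ⊆ S) (g : ℤ × ℤ → ℝ) :
    ∑ y : S, hop x y * g y = g (x.1 + 1, x.2 + 1) + g (x.1 + 1, x.2 - 1)
      + g (x.1 - 1, x.2 + 1) + g (x.1 - 1, x.2 - 1) := by
  rw [Finset.sum_coe_sort S (fun y => hop x y * g y)]
  simp only [hop_eq, ite_mul, one_mul, zero_mul]
  rw [← Finset.sum_filter, Finset.filter_mem_eq_inter, Finset.inter_eq_right.2 hx, nbrs,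
    Finset.sum_insert, Finset.sum_insert, Finset.sum_insert, Finset.sum_singleton]
  · ring
  all_goals
    simp only [Finset.mem_insert, Finset.mem_singleton, Prod.mk.injEq]
    omega

lemma sum_le_sum_of_support {S T : Finset (ℤ × ℤ)} {φ : ℤ × ℤ → ℝ} (h0 : ∀ x, 0 ≤ φ x)
    (hT : ∀ x ∈ S, φ x ≠ 0 → x ∈ T) : ∑ x : S, φ x ≤ ∑ x ∈ T, φ x := by
  rw [Finset.sum_coe_sort S φ,
    ← Finset.sum_subset (Finset.filter_subset (fun x => φ x ≠ 0) S) (by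
      intro x hx hx'
      by_contra h
      exact hx' (Finset.mem_filter.2 ⟨hx, h⟩))]
  refine Finset.sum_le_sum_of_subset_of_nonneg (fun x hx => ?_) fun x _ _ => h0 x
  obtain ⟨h1, h2⟩ := Finset.mem_filter.1 hx
  exact hT x h1 h2

lemma sum_le_card {S T : Finset (ℤ × ℤ)} {f : S → ℝ}
    (hf : ∀ x : S, f x ≤ if (x : ℤ × ℤ) ∈ T then 1 else 0) : ∑ x, f x ≤ T.card := by
  refine (Finset.sum_le_sum fun x _ => hf x).trans ?_
  refine (sum_le_sum_of_support (φ := fun x => if x ∈ T then 1 else 0) (T := T)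
    (fun x => ?_) fun x _ hx => ?_).trans ?_
  · positivity
  · by_contra h
    exact hx (if_neg h)
  · rw [Finset.sum_ite_mem]
    simp

lemma card_nbrs_le (x : ℤ × ℤ) : (nbrs x).card ≤ 4 := Finset.card_le_four

end Lattice

section Square

variable {j n L : ℤ}

lemma mem_sqΛ {x : ℤ × ℤ} :
    x ∈ sqΛ j n L ↔ (j - L ≤ x.1 ∧ x.1 ≤ j + L) ∧ (n - L ≤ x.2 ∧ x.2 ≤ n + L) := by
  simp [sqΛ]

lemma two_le_abs (hL1 : |j| ≤ L) (hL2 : L ≤ 2 * (|j| - 1)) : 2 ≤ |j| := by omega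

lemma energy_trichotomy (hP : n + j ^ 2 = 0) (hL1 : |j| ≤ L) (hL2 : L ≤ 2 * (|j| - 1))
    {x : ℤ × ℤ} (hx : x ∈ sqΛ j n L) :
    (|x.1| < |j| ∧ energy x ≤ -1 ∧ (x.1 = 0 → energy x ≤ -2)) ∨
      (x.1 = j ∧ energy x = x.2 - n) ∨ (|j| < |x.1| ∧ 3 ≤ energy x) := by
  obtain ⟨a, b⟩ := x
  rw [mem_sqΛ] at hx
  obtain ⟨⟨h1, h2⟩, h3, h4⟩ := hx
  simp only [energy] at *
  have hJ := two_le_abs hL1 hL2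
  have hj2 := sq_abs j
  have ha2 := sq_abs a
  have ha0 := abs_nonneg a
  rcases lt_trichotomy |a| |j| with h | h | h
  · refine Or.inl ⟨h, by nlinarith, fun h0 => ?_⟩
    subst h0
    nlinarith
  · refine Or.inr (Or.inl ?_)
    rcases abs_eq_abs.1 h with rfl | rfl
    · exact ⟨rfl, by linarith⟩
    · rcases abs_cases j with ⟨h5, h6⟩ | ⟨h5, h6⟩ <;> omega
  · exact Or.inr (Or.inr ⟨h, by nlinarith⟩)

lemma energy_ne_zero (hP : n + j ^ 2 = 0) (hL1 : |j| ≤ L) (hL2 : L ≤ 2 * (|j| - 1))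
    {x : ℤ × ℤ} (hx : x ∈ sqΛ j n L) (hne : x ≠ (j, n)) : energy x ≠ 0 := by
  intro h0
  rcases energy_trichotomy hP hL1 hL2 hx with h | ⟨h1, h2⟩ | h
  · omega
  · exact hne (Prod.ext h1 (by simp only; omega))
  · omega

/-- Next to a site of energy `±1`, one side carries energies of the opposite sign. -/
lemma exists_card_le_two (hP : n + j ^ 2 = 0) (hL1 : |j| ≤ L) (hL2 : L ≤ 2 * (|j| - 1))
    {x : ℤ × ℤ} (hx : x ∈ sqΛ j n L) (h1 : |energy x| = 1) :
    ∃ T : Finset (ℤ × ℤ), T.card ≤ 2 ∧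
      ∀ y ∈ nbrs x, (0 < energy x ↔ 0 < energy y) → y ∈ T := by
  have hJ := two_le_abs hL1 hL2
  obtain ⟨s, hs⟩ : ∃ s : ℤ, ∀ y ∈ nbrs x, (0 < energy x ↔ 0 < energy y) → y.1 = x.1 + s := by
    have key : (energy x = 1 ∧ 2 ≤ |x.1|) ∨ (energy x = -1 ∧ 1 ≤ |x.1|) := by
      rcases (abs_eq zero_le_one).1 h1 with h | h <;>
        rcases energy_trichotomy hP hL1 hL2 hx with ⟨h2, h3, h4⟩ | ⟨h2, h3⟩ | ⟨h2, h3⟩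
      · omega
      · rw [h2]; omega
      · omega
      · refine Or.inr ⟨h, ?_⟩
        by_contra h5
        have h6 : x.1 = 0 := abs_eq_zero.1 (by have := abs_nonneg x.1; omega)
        have := h4 h6
        omega
      · rw [h2]; omega
      · omega
    obtain ⟨a, b⟩ := x
    simp only [energy] at key ⊢
    rcases key with ⟨h, ha⟩ | ⟨h, ha⟩
    · rcases le_abs'.1 ha with ha | ha
      · refine ⟨-1, fun y hy => ?_⟩
        simp only [nbrs, Finset.mem_insert, Finset.mem_singleton] at hy
        rcases hy with rfl | rfl | rfl | rfl <;> simp only [h] <;> intro hiff <;>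
          first
          | trivial
          | omega
          | (exfalso; have := hiff.1 one_pos; nlinarith)
      · refine ⟨1, fun y hy => ?_⟩
        simp only [nbrs, Finset.mem_insert, Finset.mem_singleton] at hy
        rcases hy with rfl | rfl | rfl | rfl <;> simp only [h] <;> intro hiff <;>
          first
          | trivial
          | omega
          | (exfalso; have := hiff.1 one_pos; nlinarith)
    · rcases le_abs'.1 ha with ha | ha
      · refine ⟨1, fun y hy => ?_⟩
        simp only [nbrs, Finset.mem_insert, Finset.mem_singleton] at hy
        rcases hy with rfl | rfl | rfl | rfl <;> simp only [h] <;> intro hiff <;>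
          first
          | trivial
          | omega
          | (exfalso; exact absurd (hiff.2 (by nlinarith)) (by norm_num))
      · refine ⟨-1, fun y hy => ?_⟩
        simp only [nbrs, Finset.mem_insert, Finset.mem_singleton] at hy
        rcases hy with rfl | rfl | rfl | rfl <;> simp only [h] <;> intro hiff <;>
          first
          | trivial
          | omega
          | (exfalso; exact absurd (hiff.2 (by nlinarith)) (by norm_num))
  refine ⟨{(x.1 + s, x.2 + 1), (x.1 + s, x.2 - 1)}, Finset.card_le_two, fun y hy hiff => ?_⟩
  have h2 := hs y hy hiff
  have h3 := (mem_nbrs.1 hy).2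
  obtain ⟨c, d⟩ := y
  simp only [Finset.mem_insert, Finset.mem_singleton, Prod.mk.injEq] at *
  rw [abs_eq zero_le_one] at h3
  omega

/-- The diagonal of `H` away from the resonant site, set to `1` at the resonant site. -/
def diagAway (j n L : ℤ) (x : sqΛ j n L) : ℝ := if (x : ℤ × ℤ) = (j, n) then 1 else energy x

/-- The hopping matrix with the resonant site removed. -/
def hopAway (j n L : ℤ) : Matrix (sqΛ j n L) (sqΛ j n L) ℝ := fun x y =>
  if (x : ℤ × ℤ) = (j, n) ∨ (y : ℤ × ℤ) = (j, n) then 0 else hop x y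

/-- The coupling of the resonant site to the rest of the square. -/
def coupling (j n L : ℤ) (x : sqΛ j n L) : ℝ := hop (j, n) x

lemma hopAway_isSymm : (hopAway j n L).IsSymm := by
  ext x y
  simp only [hopAway, Matrix.transpose_apply, hop_comm (y : ℤ × ℤ), or_comm]

lemma hopAway_nonneg (x y : sqΛ j n L) : 0 ≤ hopAway j n L x y := by
  unfold hopAway
  split_ifs
  exacts [le_rfl, hop_nonneg _ _]

lemma hopAway_le (x y : sqΛ j n L) :
    hopAway j n L x y ≤ if (y : ℤ × ℤ) ∈ nbrs x then 1 else 0 := by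
  unfold hopAway
  rw [hop_eq]
  split_ifs <;> norm_num

lemma sum_hopAway_le (x : sqΛ j n L) : ∑ y, hopAway j n L x y ≤ 4 :=
  (sum_le_card (hopAway_le x)).trans (by exact_mod_cast card_nbrs_le _)

lemma diagAway_pos_iff {x : sqΛ j n L} (hx : (x : ℤ × ℤ) ≠ (j, n)) :
    0 < diagAway j n L x ↔ 0 < energy x := by
  simp [diagAway, hx]

lemma diag_dominance {δ : ℝ} (hδ0 : 0 < δ) (hδ1 : δ < 1 / 4) (hP : n + j ^ 2 = 0)
    (hL1 : |j| ≤ L) (hL2 : L ≤ 2 * (|j| - 1)) (x : sqΛ j n L) :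
    1 - 2 * δ + ∑ y, (if (0 < diagAway j n L x ↔ 0 < diagAway j n L y)
      then (δ • hopAway j n L) x y else 0) ≤ |diagAway j n L x| := by
  by_cases hx : (x : ℤ × ℤ) = (j, n)
  · simp [diagAway, hopAway, hx, hδ0.le]
  have hsum : ∑ y, (if (0 < diagAway j n L x ↔ 0 < diagAway j n L y)
      then (δ • hopAway j n L) x y else 0) = δ * ∑ y, (if (0 < diagAway j n L x ↔
        0 < diagAway j n L y) then hopAway j n L x y else 0) := by
    rw [Finset.mul_sum]
    refine Finset.sum_congr rfl fun y _ => ?_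
    split_ifs <;> simp
  rw [hsum]
  have hD : |diagAway j n L x| = ((|energy x| : ℤ) : ℝ) := by simp [diagAway, hx]
  rw [hD]
  have h0 := abs_pos.2 (energy_ne_zero hP hL1 hL2 x.2 hx)
  rcases (show |energy x| = 1 ∨ 2 ≤ |energy x| by omega) with h1 | h2
  · obtain ⟨T, hT, hmem⟩ := exists_card_le_two hP hL1 hL2 x.2 h1
    have hle : ∑ y, (if (0 < diagAway j n L x ↔ 0 < diagAway j n L y)
        then hopAway j n L x y else 0) ≤ (T.card : ℝ) := by
      refine sum_le_card fun y => ?_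
      split_ifs with h h' h'
      · exact (hopAway_le x y).trans (by split_ifs <;> norm_num)
      · by_cases hy : (y : ℤ × ℤ) = (j, n)
        · simp [hopAway, hy]
        rw [diagAway_pos_iff hx, diagAway_pos_iff hy] at h
        have : (y : ℤ × ℤ) ∉ nbrs x := fun hn => h' (hmem y hn h)
        simpa [this] using hopAway_le x y
      · norm_num
      · norm_num
    have hT' : (T.card : ℝ) ≤ 2 := by exact_mod_cast hT
    rw [h1]
    push_cast
    nlinarith [hle.trans hT']
  · have hle : ∑ y, (if (0 < diagAway j n L x ↔ 0 < diagAway j n L y)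
        then hopAway j n L x y else 0) ≤ 4 := by
      refine le_trans (Finset.sum_le_sum fun y _ => ?_) (sum_hopAway_le x)
      split_ifs
      exacts [le_rfl, hopAway_nonneg x y]
    have h2' : (2 : ℝ) ≤ ((|energy x| : ℤ) : ℝ) := by exact_mod_cast h2
    nlinarith

lemma nbrs_subset_sqΛ (hL : 1 ≤ L) : nbrs (j, n) ⊆ sqΛ j n L := by
  intro y hy
  simp only [nbrs, Finset.mem_insert, Finset.mem_singleton] at hy
  rw [mem_sqΛ]
  rcases hy with rfl | rfl | rfl | rfl <;> simp only <;> omega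

/-- The leading part of the eigenvector away from the resonant site. -/
def leading (j n L : ℤ) (x : sqΛ j n L) : ℝ := coupling j n L x * (energy x : ℝ)⁻¹

lemma diagAway_mul_leading (hP : n + j ^ 2 = 0) (hL1 : |j| ≤ L) (hL2 : L ≤ 2 * (|j| - 1))
    (x : sqΛ j n L) : diagAway j n L x * leading j n L x = coupling j n L x := by
  by_cases hx : (x : ℤ × ℤ) = (j, n)
  · simp [leading, coupling, hx, hop_self]
  · have : (energy x : ℝ) ≠ 0 := by exact_mod_cast energy_ne_zero hP hL1 hL2 x.2 hx
    simp only [diagAway, hx, if_false, leading]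
    field_simp

lemma energy_nbr (hP : n + j ^ 2 = 0) (a b : ℤ) :
    (energy (j + a, n + b) : ℝ) = 2 * a * j + a ^ 2 + b := by
  have : energy (j + a, n + b) = 2 * a * j + a ^ 2 + b := by
    simp only [energy]; linear_combination hP
  rw [this]; push_cast; ring

lemma sum_coupling_mul (hP : n + j ^ 2 = 0) (hL : 1 ≤ L) (g : ℤ × ℤ → ℝ → ℝ) :
    ∑ y : sqΛ j n L, coupling j n L y * g y (energy y)
      = g (j + 1, n + 1) (2 * j + 2) + g (j + 1, n - 1) (2 * j)
        + g (j - 1, n + 1) (-2 * j + 2) + g (j - 1, n - 1) (-2 * j) := by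
  have := sum_hop_mul (nbrs_subset_sqΛ (j := j) (n := n) hL) (fun y => g y (energy y))
  simp only [coupling]
  rw [this]
  have e1 : (energy (j + 1, n + 1) : ℝ) = 2 * j + 2 := by
    rw [energy_nbr hP]; push_cast; ring
  have e2 : (energy (j + 1, n - 1) : ℝ) = 2 * j := by
    rw [sub_eq_add_neg, energy_nbr hP]; push_cast; ring
  have e3 : (energy (j - 1, n + 1) : ℝ) = -2 * j + 2 := by
    rw [sub_eq_add_neg, energy_nbr hP]; push_cast; ring
  have e4 : (energy (j - 1, n - 1) : ℝ) = -2 * j := by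
    rw [sub_eq_add_neg, sub_eq_add_neg, energy_nbr hP]; push_cast; ring
  simp only [e1, e2, e3, e4]

lemma l2_coupling (hP : n + j ^ 2 = 0) (hL : 1 ≤ L) : l2 (coupling j n L) = 2 := by
  have h : l2 (coupling j n L) ^ 2 = 2 ^ 2 := by
    rw [l2_sq]
    have := sum_coupling_mul hP hL (fun _ _ => 1)
    simp only [mul_one] at this
    simp only [sq, coupling, hop_mul_self] at this ⊢
    rw [this]; norm_num
  exact (pow_left_inj₀ (l2_nonneg _) zero_le_two two_ne_zero).1 h

lemma coupling_dotProduct_leading (hP : n + j ^ 2 = 0) (hL1 : |j| ≤ L)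
    (hL2 : L ≤ 2 * (|j| - 1)) :
    coupling j n L ⬝ᵥ leading j n L = -1 / (|(j : ℝ)| ^ 2 - 1) := by
  have hJ := two_le_abs hL1 hL2
  have hJ' : (2 : ℝ) ≤ |(j : ℝ)| := by exact_mod_cast hJ
  have := sum_coupling_mul hP (by omega : 1 ≤ L) (fun _ d => d⁻¹)
  simp only [dotProduct, leading, ← mul_assoc]
  simp only [coupling, hop_mul_self] at this ⊢
  rw [this, sq_abs]
  have hj : (j : ℝ) ≠ 0 := by rintro h; rw [h] at hJ'; norm_num at hJ'
  have h1 : (j : ℝ) + 1 ≠ 0 := by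
    intro h; rw [eq_neg_of_add_eq_zero_left h] at hJ'; norm_num at hJ'
  have h2 : (j : ℝ) - 1 ≠ 0 := by
    intro h; rw [sub_eq_zero.1 h] at hJ'; norm_num at hJ'
  have e1 : (2 * j + 2 : ℝ) = 2 * (j + 1) := by ring
  have e2 : (-2 * j + 2 : ℝ) = -2 * (j - 1) := by ring
  have e3 : (j : ℝ) ^ 2 - 1 = (j + 1) * (j - 1) := by ring
  rw [e1, e2, e3]
  field_simp
  ring

lemma l2_leading_le (hP : n + j ^ 2 = 0) (hL1 : |j| ≤ L) (hL2 : L ≤ 2 * (|j| - 1)) :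
    l2 (leading j n L) ≤ 2 / |(j : ℝ)| := by
  have hJ := two_le_abs hL1 hL2
  have hJ' : (2 : ℝ) ≤ |(j : ℝ)| := by exact_mod_cast hJ
  refine le_of_sq_le_sq ?_ (by positivity)
  have := sum_coupling_mul hP (by omega : 1 ≤ L) (fun _ d => (d ^ 2)⁻¹)
  have h : l2 (leading j n L) ^ 2
      = ∑ y : sqΛ j n L, coupling j n L y * ((energy y : ℝ) ^ 2)⁻¹ := by
    rw [l2_sq]
    refine Finset.sum_congr rfl fun y _ => ?_
    simp only [leading, mul_pow, inv_pow]
    simp only [coupling, sq, hop_mul_self]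
  rw [h, this, div_pow, sq_abs]
  have hj2 : 4 ≤ (j : ℝ) ^ 2 := by rw [← sq_abs]; nlinarith
  have key : ∀ d : ℝ, (j : ℝ) ^ 2 ≤ d ^ 2 → (d ^ 2)⁻¹ ≤ 1 / (j : ℝ) ^ 2 := fun d hd => by
    rw [one_div]
    exact inv_anti₀ (by linarith) hd
  have hjs : 2 * |(j : ℝ)| ≤ (j : ℝ) ^ 2 := by rw [← sq_abs]; nlinarith
  have hja := neg_abs_le (j : ℝ)
  have hjb := le_abs_self (j : ℝ)
  have k1 := key (2 * j + 2) (by nlinarith [sq_nonneg ((j : ℝ) + 2)])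
  have k2 := key (2 * j) (by nlinarith)
  have k3 := key (-2 * j + 2) (by nlinarith [sq_nonneg ((j : ℝ) - 2)])
  have k4 := key (-2 * j) (by nlinarith)
  calc _ ≤ 1 / (j : ℝ) ^ 2 + 1 / (j : ℝ) ^ 2 + 1 / (j : ℝ) ^ 2 + 1 / (j : ℝ) ^ 2 := by gcongr
    _ = 2 ^ 2 / (j : ℝ) ^ 2 := by ring

lemma leading_dotProduct_hopAway :
    leading j n L ⬝ᵥ (hopAway j n L).mulVec (leading j n L) = 0 := by
  simp only [dotProduct, Matrix.mulVec, Finset.mul_sum]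
  refine Finset.sum_eq_zero fun x _ => Finset.sum_eq_zero fun y _ => ?_
  by_contra h
  have hx : leading j n L x ≠ 0 := left_ne_zero_of_mul h
  have hxy : hopAway j n L x y ≠ 0 := left_ne_zero_of_mul (right_ne_zero_of_mul h)
  have hy : leading j n L y ≠ 0 := right_ne_zero_of_mul (right_ne_zero_of_mul h)
  have hx' := left_ne_zero_of_mul hx
  have hy' := left_ne_zero_of_mul hy
  have hxy' : hop x y ≠ 0 := fun h0 => hxy (by simp [hopAway, h0])
  simp only [coupling, hop, ne_eq, ite_eq_right_iff, Classical.not_imp, one_ne_zero,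
    not_false_eq_true, and_true] at hx' hy' hxy'
  have h1 := hx'.1
  have h2 := hy'.1
  have h3 := hxy'.1
  rw [abs_eq zero_le_one] at h1 h2 h3
  omega

/-- The leading vector after one hop, in coordinates centred at the resonant site. -/
def secondHop (j : ℤ) (e : ℤ × ℤ) : ℝ :=
  hop e (1, 1) * (2 * j + 2 : ℝ)⁻¹ + hop e (1, -1) * (2 * j : ℝ)⁻¹
    + hop e (-1, 1) * (-2 * j + 2 : ℝ)⁻¹ + hop e (-1, -1) * (-2 * j : ℝ)⁻¹

lemma hop_add_left (x e f : ℤ × ℤ) : hop (x + e) (x + f) = hop e f := by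
  simp [hop]

lemma hopAway_mulVec_leading (hP : n + j ^ 2 = 0) (hL : 1 ≤ L) {x : sqΛ j n L}
    (hx : (x : ℤ × ℤ) ≠ (j, n)) :
    (hopAway j n L).mulVec (leading j n L) x = secondHop j ((x : ℤ × ℤ) - (j, n)) := by
  have h := sum_coupling_mul hP hL (fun y d => hop x y * d⁻¹)
  have h1 : (hopAway j n L).mulVec (leading j n L) x
      = ∑ y : sqΛ j n L, coupling j n L y * (hop x y * (energy y : ℝ)⁻¹) := by
    refine Finset.sum_congr rfl fun y _ => ?_
    by_cases hy : (y : ℤ × ℤ) = (j, n)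
    · simp [leading, coupling, hy, hop_self]
    · simp only [hopAway, hx, hy, or_self, if_false, leading]
      ring
  have h2 : ∀ f, hop x ((j, n) + f) = hop ((x : ℤ × ℤ) - (j, n)) f := fun f => by
    rw [← hop_add_left (j, n) ((x : ℤ × ℤ) - (j, n)) f, add_sub_cancel]
  have e1 := h2 (1, 1)
  have e2 := h2 (1, -1)
  have e3 := h2 (-1, 1)
  have e4 := h2 (-1, -1)
  simp only [Prod.mk_add_mk, ← sub_eq_add_neg] at e1 e2 e3 e4
  rw [h1, h, e1, e2, e3, e4]
  rfl

/-- The relative positions of the sites reached from the resonant site in two hops. -/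
def secondNbrs : Finset (ℤ × ℤ) :=
  {(0, 2), (0, -2), (2, 2), (2, 0), (2, -2), (-2, 2), (-2, 0), (-2, -2)}

lemma mem_secondNbrs {e : ℤ × ℤ} (he : e ≠ 0) (h : secondHop j e ≠ 0) : e ∈ secondNbrs := by
  obtain ⟨a, b⟩ := e
  contrapose! h
  simp only [secondNbrs, Finset.mem_insert, Finset.mem_singleton, Prod.mk.injEq, ne_eq,
    Prod.mk_eq_zero] at he h
  have h0 : ∀ s t : ℤ, (s = 1 ∨ s = -1) → (t = 1 ∨ t = -1) → hop (a, b) (s, t) = 0 := by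
    intro s t hs ht
    refine if_neg ?_
    simp only [abs_eq (zero_le_one' ℤ)]
    omega
  simp [secondHop, h0]

lemma sum_secondHop_sq (hJ : 2 ≤ |j|) :
    ∑ e ∈ secondNbrs, secondHop j e ^ 2 ≤ 4 / (|(j : ℝ)| ^ 2 - 1) := by
  have hJ' : (2 : ℝ) ≤ |(j : ℝ)| := by exact_mod_cast hJ
  have hj : (j : ℝ) ≠ 0 := by rintro h; rw [h] at hJ'; norm_num at hJ'
  have h1 : (j : ℝ) + 1 ≠ 0 := by
    intro h; rw [eq_neg_of_add_eq_zero_left h] at hJ'; norm_num at hJ'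
  have h2 : (j : ℝ) - 1 ≠ 0 := by
    intro h; rw [sub_eq_zero.1 h] at hJ'; norm_num at hJ'
  have hm : 3 ≤ (j : ℝ) ^ 2 - 1 := by rw [← sq_abs]; nlinarith
  have e1 : (2 * j + 2 : ℝ) = 2 * (j + 1) := by ring
  have e2 : (-2 * j + 2 : ℝ) = -2 * (j - 1) := by ring
  have hsum : ∑ e ∈ secondNbrs, secondHop j e ^ 2
      = (3 + 3 / ((j : ℝ) ^ 2 - 1) - 1 / (j : ℝ) ^ 2) / ((j : ℝ) ^ 2 - 1) := by
    have e3 : (j : ℝ) ^ 2 - 1 = (j + 1) * (j - 1) := by ring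
    simp only [secondHop, e1, e2, e3]
    simp [secondNbrs, hop]
    field_simp
    ring
  rw [hsum, sq_abs]
  refine div_le_div_of_nonneg_right ?_ (by linarith)
  have : 3 / ((j : ℝ) ^ 2 - 1) ≤ 1 := (div_le_one (by linarith)).2 hm
  have : 0 ≤ 1 / (j : ℝ) ^ 2 := by positivity
  linarith

lemma l2_hopAway_leading (hP : n + j ^ 2 = 0) (hL1 : |j| ≤ L) (hL2 : L ≤ 2 * (|j| - 1)) :
    l2 ((hopAway j n L).mulVec (leading j n L)) ^ 2 ≤ 4 / (|(j : ℝ)| ^ 2 - 1) := by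
  have hJ := two_le_abs hL1 hL2
  refine le_trans ?_ (sum_secondHop_sq hJ)
  set φ : ℤ × ℤ → ℝ := fun x => if x = (j, n) then 0 else secondHop j (x - (j, n)) ^ 2 with hφ
  have h1 : l2 ((hopAway j n L).mulVec (leading j n L)) ^ 2 = ∑ x : sqΛ j n L, φ x := by
    rw [l2_sq]
    refine Finset.sum_congr rfl fun x _ => ?_
    by_cases hx : (x : ℤ × ℤ) = (j, n)
    · simp [hφ, hx, Matrix.mulVec, dotProduct, hopAway]
    · simp only [hφ, hx, if_false, hopAway_mulVec_leading hP (by omega) hx]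
  rw [h1]
  refine (sum_le_sum_of_support (T := secondNbrs.map (addLeftEmbedding (j, n)))
    (fun x => ?_) fun x _ hx => ?_).trans ?_
  · simp only [hφ]; positivity
  · have hne : x ≠ (j, n) := fun h => hx (by simp [hφ, h])
    simp only [hφ, hne, if_false] at hx
    refine Finset.mem_map.2 ⟨x - (j, n), mem_secondNbrs (sub_ne_zero.2 hne) (pow_ne_zero_iff
      two_ne_zero |>.1 hx), ?_⟩
    simp
  · rw [Finset.sum_map]
    refine Finset.sum_le_sum fun e _ => ?_
    simp only [hφ, addLeftEmbedding_apply, add_sub_cancel_left]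
    split_ifs
    exacts [sq_nonneg _, le_rfl]

lemma newtonData_sqΛ {δ C : ℝ} (hδ0 : 0 < δ) (hδ1 : δ < 1 / 4) (hC : C = 1 / (1 - 2 * δ))
    (hP : n + j ^ 2 = 0) (hj : 8 * δ * C ^ 2 < |(j : ℝ)|) (hL1 : |j| ≤ L)
    (hL2 : L ≤ 2 * (|j| - 1)) :
    NewtonData (diagAway j n L) (hopAway j n L) (coupling j n L) (leading j n L) δ C |(j : ℝ)| := by
  have hJ := two_le_abs hL1 hL2
  have hpos : 0 < 1 - 2 * δ := by linarith
  refine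
  { δ_pos := hδ0
    δ_lt := hδ1
    C_eq := by rw [hC, one_div_mul_cancel hpos.ne']
    lt_J := hj
    two_le_J := by exact_mod_cast hJ
    symm := hopAway_isSymm
    coercive := fun f => ?_
    schur := l2_mulVec_le hopAway_isSymm hopAway_nonneg sum_hopAway_le
    diag_mul := diagAway_mul_leading hP hL1 hL2
    l2_b := l2_coupling hP (by omega)
    l2_p := l2_leading_le hP hL1 hL2
    b_p := coupling_dotProduct_leading hP hL1 hL2
    p_B_p := leading_dotProduct_hopAway
    l2_B_p := l2_hopAway_leading hP hL1 hL2 }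
  have := mul_l2_le_l2_mulVec (hopAway_isSymm.smul δ)
    (fun x y => mul_nonneg hδ0.le (hopAway_nonneg x y))
    (diag_dominance hδ0 hδ1 hP hL1 hL2) f
  rw [hC, one_div_mul_eq_div, le_div_iff₀ hpos]
  linarith

end Square

section Main

variable {j n L : ℤ}

lemma norm2_ofReal {S : Finset (ℤ × ℤ)} (f : S → ℝ) :
    norm2 (fun x => (f x : ℂ)) = l2 f := by
  simp only [norm2, Complex.norm_real, Real.norm_eq_abs, sq_abs]
  rw [← l2_sq, Real.sqrt_sq (l2_nonneg f)]

lemma map_ofReal_mulVec {S : Finset (ℤ × ℤ)} (M : Matrix S S ℝ) (f : S → ℝ) :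
    (M.map ((↑) : ℝ → ℂ)).mulVec (fun x => (f x : ℂ)) = fun x => ((M.mulVec f x : ℝ) : ℂ) := by
  ext x
  simp [Matrix.mulVec, dotProduct]

lemma Hmat_apply (δ : ℝ) (S : Finset (ℤ × ℤ)) (x y : S) :
    Hmat δ S x y = (if x = y then (energy x : ℝ) else 0) + δ * hop x y := by
  by_cases h : x = y
  · subst h
    simp [Hmat, energy, hop]
  · have h' : (x : ℤ × ℤ) ≠ y := fun e => h (Subtype.ext e)
    simp only [Hmat, h, h', if_false, hop, mul_ite, mul_one, mul_zero, zero_add]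

/-- The action of `H` on a vector equal to `1` at the resonant site. -/
lemma Hmat_mulVec_center_add (δ : ℝ) (hP : n + j ^ 2 = 0) (o : sqΛ j n L)
    (ho : (o : ℤ × ℤ) = (j, n)) {v : sqΛ j n L → ℝ} (hv : v o = 0) :
    (Hmat δ (sqΛ j n L)).mulVec (Pi.single o 1 + v)
      = Pi.single o (δ * (coupling j n L ⬝ᵥ v)) + δ • coupling j n L
        + (Matrix.diagonal (diagAway j n L) + δ • hopAway j n L).mulVec v := by
  ext x
  have h1 : (Hmat δ (sqΛ j n L)).mulVec (Pi.single o 1 + v) x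
      = Hmat δ (sqΛ j n L) x o + (energy x * v x + δ * ∑ y : sqΛ j n L, hop x y * v y) := by
    rw [Matrix.mulVec_add, Pi.add_apply, Matrix.mulVec_single_one]
    congr 1
    simp only [Matrix.mulVec, dotProduct, Hmat_apply, add_mul, Finset.sum_add_distrib, ite_mul,
      zero_mul, Finset.sum_ite_eq, Finset.mem_univ, if_true, Finset.mul_sum, mul_assoc]
  have hval : ∀ y : sqΛ j n L, (y : ℤ × ℤ) = (j, n) ↔ y = o := fun y => by
    rw [← ho, Subtype.ext_iff]
  have henergy : energy (j, n) = 0 := hP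
  rw [h1, Hmat_apply, Matrix.add_mulVec, Matrix.smul_mulVec]
  simp only [Pi.add_apply, Pi.smul_apply, smul_eq_mul, Matrix.mulVec_diagonal, coupling, diagAway,
    hval]
  by_cases hx : x = o
  · subst hx
    simp [henergy, hv, ho, hop_self, Matrix.mulVec, dotProduct, hopAway, coupling]
  · have h2 : (hopAway j n L).mulVec v x = ∑ y : sqΛ j n L, hop x y * v y := by
      refine Finset.sum_congr rfl fun y _ => ?_
      by_cases hy : y = o
      · rw [hy, hv, mul_zero, mul_zero]
      · simp [hopAway, hval, hx, hy]
    rw [h2]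
    simp only [hx, if_false, Pi.single_apply, ho, hop_comm (x : ℤ × ℤ) (j, n)]

/-- The action of the reduced operator at the resonant site is trivial. -/
lemma away_mulVec_center (δ : ℝ) (o : sqΛ j n L) (ho : (o : ℤ × ℤ) = (j, n))
    (v : sqΛ j n L → ℝ) :
    (Matrix.diagonal (diagAway j n L) + δ • hopAway j n L).mulVec v o = v o := by
  rw [Matrix.add_mulVec, Matrix.smul_mulVec, Pi.add_apply, Matrix.mulVec_diagonal]
  simp [diagAway, hopAway, ho, Matrix.mulVec, dotProduct]

end Main

/-- Lemma 3.1: convergence of the Newton scheme for `H_{Λ_j}`. -/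
theorem newton_scheme_converges (δ : ℝ) (hδ0 : 0 < δ) (hδ1 : δ < 1 / 4)
    (C : ℝ) (hC : C = 1 / (1 - 2 * δ))
    (j n L : ℤ) (hP : n + j ^ 2 = 0) (hj : 8 * δ * C ^ 2 < |(j : ℝ)|)
    (hL1 : |j| ≤ L) (hL2 : L ≤ 2 * (|j| - 1)) :
    ∃ (E : ℕ → ℝ) (u : ℕ → ((sqΛ j n L) → ℂ)) (F : ℕ → ((sqΛ j n L) → ℂ)),
      E 0 = 0 ∧
      u 0 = (fun x : (sqΛ j n L) => if (x : ℤ × ℤ) = (j, n) then (1 : ℂ) else 0) ∧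
      (∀ k : ℕ, F k =
        ((Hmat δ (sqΛ j n L)).map ((↑) : ℝ → ℂ)).mulVec (u k) - (E k : ℂ) • u k) ∧
      (∀ (k : ℕ) (x : (sqΛ j n L)), (x : ℤ × ℤ) = (j, n) → u k x = 1) ∧
      (∀ (k : ℕ) (x : (sqΛ j n L)), (x : ℤ × ℤ) ≠ (j, n) →
        (((Hmat δ (sqΛ j n L)).map ((↑) : ℝ → ℂ)).mulVec (u (k + 1))
          - (E k : ℂ) • u (k + 1)) x = 0) ∧
      (∀ (k : ℕ) (x : (sqΛ j n L)), (x : ℤ × ℤ) = (j, n) →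
        (((Hmat δ (sqΛ j n L)).map ((↑) : ℝ → ℂ)).mulVec (u (k + 1))
          - (E (k + 1) : ℂ) • u (k + 1)) x = 0) ∧
      norm2 (F 0) = 2 * δ ∧
      (∀ k : ℕ, 1 ≤ k →
        norm2 (F k) ≤ (2 * C ^ 2 * norm2 (F 0) / |(j : ℝ)|) * norm2 (F (k - 1)) ∧
        norm2 (F k) < (1 / 2) * norm2 (F (k - 1)) ∧
        |E k - E (k - 1)| ≤ (C / |(j : ℝ)|) * norm2 (F (k - 1))) := by
  have h := newtonData_sqΛ hδ0 hδ1 hC hP hj hL1 hL2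
  let o : sqΛ j n L := ⟨(j, n), mem_sqΛ.2 ⟨⟨by omega, by omega⟩, by omega, by omega⟩⟩
  have ho : (o : ℤ × ℤ) = (j, n) := rfl
  have hval : ∀ y : sqΛ j n L, (y : ℤ × ℤ) = (j, n) ↔ y = o := fun y => by
    rw [← ho, Subtype.ext_iff]
  have hco : coupling j n L o = 0 := hop_self _
  obtain ⟨E, v, F, hE0, hv0, hF, hE, hEv, hv, hF0, hest⟩ := h.exists_iterates
  have hvo : ∀ k, v k o = 0 := by
    rintro (_ | k)
    · rw [hv0]; rfl
    · have h1 := congrFun (hv k) o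
      rw [Pi.sub_apply, away_mulVec_center δ o ho, Pi.smul_apply, Pi.smul_apply, hco, smul_zero,
        smul_eq_mul] at h1
      have h2 : (1 - E k) * v (k + 1) o = 0 := by linear_combination h1
      refine (mul_eq_zero.1 h2).resolve_left fun h3 => ?_
      have h4 := hE k
      rw [← sub_eq_zero.1 h3, abs_one] at h4
      linarith [h.one_lt_C]
  set u : ℕ → sqΛ j n L → ℝ := fun k => Pi.single o 1 + v k with hu
  have hHu : ∀ (k : ℕ) (e : ℝ), (Hmat δ (sqΛ j n L)).mulVec (u k) - e • u k
      = Pi.single o (E k - e) + (δ • coupling j n L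
        + ((Matrix.diagonal (diagAway j n L) + δ • hopAway j n L).mulVec (v k) - e • v k)) := by
    intro k e
    rw [hu, Hmat_mulVec_center_add δ hP o ho (hvo k), ← hEv, Pi.single_sub, smul_add,
      ← Pi.single_smul, smul_eq_mul, mul_one]
    abel
  have hcast : ∀ (k : ℕ) (e : ℝ), ((Hmat δ (sqΛ j n L)).map ((↑) : ℝ → ℂ)).mulVec
      (fun x => (u k x : ℂ)) - (e : ℂ) • (fun x => (u k x : ℂ))
      = fun x => ((((Hmat δ (sqΛ j n L)).mulVec (u k) - e • u k) x : ℝ) : ℂ) := by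
    intro k e
    rw [map_ofReal_mulVec]
    ext x
    simp
  have hFu : ∀ k, (Hmat δ (sqΛ j n L)).mulVec (u k) - E k • u k = F k := fun k => by
    rw [hHu, sub_self, Pi.single_zero, zero_add, hF, add_comm]
  refine ⟨E, fun k x => (u k x : ℂ), fun k x => (F k x : ℂ), hE0, ?_, fun k => ?_, ?_, ?_, ?_,
    ?_, ?_⟩
  · ext x
    simp only [hu, hv0, add_zero, Pi.single_apply, hval]
    split_ifs <;> simp
  · rw [hcast, hFu]
  · intro k x hx
    rw [(hval x).1 hx]
    simp [hu, hvo]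
  · intro k x hx
    rw [hcast, hHu, hv]
    have : x ≠ o := fun e => hx ((hval x).2 e)
    simp [this]
  · intro k x hx
    have hFo : F (k + 1) o = 0 := by
      rw [hF, Pi.add_apply, Pi.sub_apply, away_mulVec_center δ o ho]
      simp [hvo, hco]
    rw [hcast, hFu, (hval x).1 hx]
    simp only [hFo, Complex.ofReal_zero]
  · rw [norm2_ofReal, hF0]
  · intro k hk
    obtain ⟨k, rfl⟩ := Nat.exists_eq_add_of_le' hk
    simp only [norm2_ofReal, add_tsub_cancel_right]
    exact hest k
end
end

section
/- For every δ with 0 < δ < 1/4 there exist α > 0 and j₀ such that the following holds for every (j,n) ∈ P with |j| > j₀ and every admissible L: if φ : Λ_j → ℂ with ‖φ‖₂ = 1 satisfies H_{Λ_j}φ = λφ for some λ ∈ [−2δ, 2δ], then (Σ_{x ∈ ∂Λ_j} |φ(x)|²)^{1/2} ≤ e^{−α|j|}, where ∂Λ_j is the set of points x = (j_x, n_x) ∈ Λ_j having a neighbor y = (j_y, n_y) ∉ Λ_j with |j_x − j_y| = 1 and |n_x − n_y| = 1. -/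
noncomputable section

/-- The boundary of `Λ_j` relative to `ℤ × ℤ`: the points of `Λ_j` having a diagonal
neighbor (a point at distance 1 in each coordinate) outside `Λ_j`. -/
def bdry (j n L : ℤ) : Finset (ℤ × ℤ) :=
  (sqΛ j n L).filter fun x =>
    (x.1 + 1, x.2 + 1) ∉ sqΛ j n L ∨ (x.1 + 1, x.2 - 1) ∉ sqΛ j n L ∨
    (x.1 - 1, x.2 + 1) ∉ sqΛ j n L ∨ (x.1 - 1, x.2 - 1) ∉ sqΛ j n L

/-- The diagonal entry of the Hamiltonian at the site `x`. -/
def sitePotential (x : ℤ × ℤ) : ℤ := x.2 + x.1 ^ 2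

/-- Diagonal neighbors in `ℤ × ℤ`. -/
def IsDiagNeighbor (x y : ℤ × ℤ) : Prop := |x.1 - y.1| = 1 ∧ |x.2 - y.2| = 1

/-- The maximum distance of `x` from `(j, n)`. -/
def supDist (j n : ℤ) (x : ℤ × ℤ) : ℤ := max |x.1 - j| |x.2 - n|

lemma Finset.card_filter_diagNeighbor_le (S : Finset (ℤ × ℤ)) (x : ℤ × ℤ) :
    (S.filter fun y => |x.1 - y.1| = 1 ∧ |x.2 - y.2| = 1).card ≤ 4 := by
  refine (Finset.card_le_card (t := {(x.1 + 1, x.2 + 1), (x.1 + 1, x.2 - 1),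
    (x.1 - 1, x.2 + 1), (x.1 - 1, x.2 - 1)}) ?_).trans Finset.card_le_four
  rintro ⟨a, b⟩ h
  simp only [Finset.mem_filter, abs_eq zero_le_one] at h
  simp only [Finset.mem_insert, Finset.mem_singleton, Prod.mk.injEq]
  omega

lemma mulVec_Hmat_apply (δ : ℝ) (S : Finset (ℤ × ℤ)) (φ : S → ℂ) (x : S) :
    ((Hmat δ S).map ((↑) : ℝ → ℂ)).mulVec φ x =
      (sitePotential x : ℂ) * φ x +
        ∑ y : S, if |(x : ℤ × ℤ).1 - (y : ℤ × ℤ).1| = 1 ∧ |(x : ℤ × ℤ).2 - (y : ℤ × ℤ).2| = 1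
          then (δ : ℂ) * φ y else 0 := by
  have hdiag : (sitePotential x : ℂ) * φ x =
      ∑ y : S, if x = y then (sitePotential x : ℂ) * φ y else 0 := by simp
  rw [hdiag, ← Finset.sum_add_distrib]
  refine Finset.sum_congr rfl fun y _ => ?_
  by_cases hxy : x = y
  · subst hxy
    simp [Hmat, sitePotential]
  · have hxy' : (x : ℤ × ℤ) ≠ y := fun h => hxy (Subtype.ext h)
    simp only [Hmat, Matrix.map_apply, hxy, hxy', if_false, zero_add]
    split_ifs <;> simp

/-- An eigenfunction is controlled at `x` by its values at the neighbors of `x`. -/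
lemma abs_potential_sub_mul_norm_le {δ : ℝ} (hδ : 0 ≤ δ) {S : Finset (ℤ × ℤ)} {φ : S → ℂ}
    {lam : ℝ} (h : ((Hmat δ S).map ((↑) : ℝ → ℂ)).mulVec φ = (lam : ℂ) • φ) (x : S) {M : ℝ}
    (hM : 0 ≤ M) (hφ : ∀ y : S, IsDiagNeighbor x y → ‖φ y‖ ≤ M) :
    |(sitePotential x : ℝ) - lam| * ‖φ x‖ ≤ 4 * δ * M := by
  have hx := congrFun h x
  rw [mulVec_Hmat_apply, Pi.smul_apply, smul_eq_mul] at hx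
  have heq : (((sitePotential x : ℝ) - lam : ℝ) : ℂ) * φ x =
      -∑ y : S, if |(x : ℤ × ℤ).1 - (y : ℤ × ℤ).1| = 1 ∧ |(x : ℤ × ℤ).2 - (y : ℤ × ℤ).2| = 1
        then (δ : ℂ) * φ y else 0 := by
    push_cast
    linear_combination hx
  rw [← Real.norm_eq_abs, ← Complex.norm_real, ← norm_mul, heq, norm_neg]
  calc _ ≤ ∑ y : S, if |(x : ℤ × ℤ).1 - (y : ℤ × ℤ).1| = 1 ∧
          |(x : ℤ × ℤ).2 - (y : ℤ × ℤ).2| = 1 then δ * M else 0 := by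
        refine norm_sum_le_of_le _ fun y _ => ?_
        split_ifs with hy
        · rw [norm_mul, Complex.norm_real, Real.norm_of_nonneg hδ]
          exact mul_le_mul_of_nonneg_left (hφ y hy) hδ
        · simp
    _ = ∑ y ∈ S, if |(x : ℤ × ℤ).1 - y.1| = 1 ∧ |(x : ℤ × ℤ).2 - y.2| = 1
          then δ * M else 0 :=
        Finset.sum_coe_sort S fun y =>
          if |(x : ℤ × ℤ).1 - y.1| = 1 ∧ |(x : ℤ × ℤ).2 - y.2| = 1 then δ * M else 0
    _ = (S.filter fun y => |(x : ℤ × ℤ).1 - y.1| = 1 ∧ |(x : ℤ × ℤ).2 - y.2| = 1).card *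
          (δ * M) := by
        rw [← Finset.sum_filter, Finset.sum_const, nsmul_eq_mul]
    _ ≤ 4 * (δ * M) := by
        gcongr
        exact_mod_cast Finset.card_filter_diagNeighbor_le S x
    _ = 4 * δ * M := by ring

lemma mem_sqΛ_iff {j n L : ℤ} {x : ℤ × ℤ} :
    x ∈ sqΛ j n L ↔ |x.1 - j| ≤ L ∧ |x.2 - n| ≤ L := by
  simp only [sqΛ, Finset.mem_product, Finset.mem_Icc, abs_le]
  omega

lemma le_supDist_of_mem_bdry {j n L : ℤ} {x : ℤ × ℤ} (hx : x ∈ bdry j n L) :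
    L ≤ supDist j n x := by
  simp only [bdry, Finset.mem_filter, mem_sqΛ_iff, abs_le] at hx
  simp only [supDist, le_max_iff, le_abs]
  omega

lemma IsDiagNeighbor.supDist_le {j n : ℤ} {x y : ℤ × ℤ} (h : IsDiagNeighbor x y) :
    supDist j n x ≤ supDist j n y + 1 := by
  obtain ⟨h₁, h₂⟩ := h
  have h₃ := abs_sub_le x.1 y.1 j
  have h₄ := abs_sub_le x.2 y.2 n
  simp only [supDist]
  omega

/-- The center is the only resonant site of an admissible square. -/
lemma one_le_abs_sitePotential {j n L : ℤ} (hP : n + j ^ 2 = 0) (hL : L ≤ 2 * (|j| - 1))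
    {x : ℤ × ℤ} (hx : x ∈ sqΛ j n L) (hd : 0 < supDist j n x) : 1 ≤ |sitePotential x| := by
  refine Int.one_le_abs fun h0 => ?_
  rw [mem_sqΛ_iff] at hx
  obtain ⟨a, b⟩ := x
  simp only [sitePotential, supDist] at *
  obtain ⟨ha, hb⟩ := hx
  have hdiff : b - n = |j| ^ 2 - |a| ^ 2 := by rw [sq_abs, sq_abs]; linarith
  rw [hdiff, abs_le] at hb
  have h1 : |a| = |j| := by
    rcases lt_trichotomy |a| |j| with h | h | h
    · nlinarith [abs_nonneg a]
    · exact h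
    · nlinarith [abs_nonneg j]
  rcases abs_eq_abs.mp h1 with h2 | h2
  · subst h2
    have : b = n := by linarith
    simp [this] at hd
  · subst h2
    rw [abs_le] at ha
    rcases abs_cases j with h3 | h3 <;> omega

/-- Neighbors of a site with small potential have large potential. -/
lemma five_le_abs_sitePotential {j n L : ℤ} (hP : n + j ^ 2 = 0) (hj : 10 ≤ |j|)
    (hL : L ≤ 2 * (|j| - 1)) {x y : ℤ × ℤ} (hx : x ∈ sqΛ j n L) (hV : |sitePotential x| ≤ 2)
    (hxy : IsDiagNeighbor x y) : 5 ≤ |sitePotential y| := by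
  rw [mem_sqΛ_iff] at hx
  obtain ⟨a, b⟩ := x
  obtain ⟨c, d⟩ := y
  obtain ⟨h1, h2⟩ := hxy
  simp only [sitePotential] at *
  have ha : 5 ≤ |a| := by
    by_contra! h
    have h3 : a ^ 2 ≤ 16 := by
      rw [← sq_abs]
      nlinarith [abs_nonneg a]
    have h4 := abs_le.mp hx.2
    have h5 := abs_le.mp hV
    have h6 : |j| ^ 2 = j ^ 2 := sq_abs j
    nlinarith
  have h5 := abs_le.mp hV
  rw [le_abs]
  rw [le_abs] at ha
  rw [abs_eq zero_le_one] at h1 h2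
  rcases h1 with h1 | h1
  · obtain rfl : c = a - 1 := by omega
    ring_nf at *
    omega
  · obtain rfl : c = a + 1 := by omega
    ring_nf at *
    omega

/-- Exponential decay of eigenfunctions away from the center of an admissible square. -/
lemma norm_le_half_pow {δ : ℝ} (hδ0 : 0 ≤ δ) (hδ1 : δ ≤ 1 / 4) {j n L : ℤ}
    (hP : n + j ^ 2 = 0) (hj : 10 ≤ |j|) (hL : L ≤ 2 * (|j| - 1)) {φ : sqΛ j n L → ℂ} {lam : ℝ}
    (hφ : ∀ x, ‖φ x‖ ≤ 1) (hlam : |lam| ≤ 2 * δ)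
    (h : ((Hmat δ (sqΛ j n L)).map ((↑) : ℝ → ℂ)).mulVec φ = (lam : ℂ) • φ) (N : ℕ) :
    ∀ x : sqΛ j n L, 2 * (N : ℤ) ≤ supDist j n x → ‖φ x‖ ≤ (1 / 2 : ℝ) ^ N := by
  induction N with
  | zero => exact fun x _ => (hφ x).trans_eq (pow_zero _).symm
  | succ N ih =>
    intro x hx
    push_cast at hx
    set M : ℝ := (1 / 2 : ℝ) ^ N with hMdef
    have hM : 0 ≤ M := by positivity
    have gap : ∀ (y : sqΛ j n L) (k : ℤ), k ≤ |sitePotential y| →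
        (k : ℝ) - 1 / 2 ≤ |(sitePotential y : ℝ) - lam| := fun y k hk => by
      have h1 : (k : ℝ) ≤ |(sitePotential y : ℝ)| := by exact_mod_cast hk
      have h2 := abs_sub_abs_le_abs_sub (sitePotential y : ℝ) lam
      linarith
    have step : ∀ (y : sqΛ j n L) (k : ℤ) (B : ℝ), k ≤ |sitePotential y| → 0 ≤ B →
        (∀ z : sqΛ j n L, IsDiagNeighbor y z → ‖φ z‖ ≤ B) →
        ((k : ℝ) - 1 / 2) * ‖φ y‖ ≤ B := fun y k B hk hB hz =>
      calc ((k : ℝ) - 1 / 2) * ‖φ y‖ ≤ |(sitePotential y : ℝ) - lam| * ‖φ y‖ :=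
            mul_le_mul_of_nonneg_right (gap y k hk) (norm_nonneg _)
        _ ≤ 4 * δ * B := abs_potential_sub_mul_norm_le hδ0 h y hB hz
        _ ≤ B := by nlinarith
    rw [pow_succ, ← hMdef]
    rcases le_or_gt 3 |sitePotential x| with hV | hV
    · have := step x 3 M hV hM fun y hy => ih y (by
        have := hy.supDist_le (j := j) (n := n)
        omega)
      push_cast at this
      linarith
    · have hy : ∀ y : sqΛ j n L, IsDiagNeighbor x y → ‖φ y‖ ≤ M / 4 := fun y hxy => by
        have := step y 5 M
          (five_le_abs_sitePotential hP hj hL x.2 (by omega) hxy) hM fun z hz => ih z (by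
            have := hxy.supDist_le (j := j) (n := n)
            have := hz.supDist_le (j := j) (n := n)
            omega)
        push_cast at this
        linarith [norm_nonneg (φ y)]
      have := step x 1 (M / 4) (one_le_abs_sitePotential hP hL x.2 (by omega)) (by positivity) hy
      push_cast at this
      linarith

lemma card_sqΛ (j n : ℤ) {L : ℤ} (hL : 0 ≤ L) : ((sqΛ j n L).card : ℝ) = (2 * L + 1) ^ 2 := by
  have h : ((2 * L + 1).toNat : ℝ) = 2 * L + 1 := by
    have : ((2 * L + 1).toNat : ℤ) = 2 * L + 1 := Int.toNat_of_nonneg (by omega)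
    exact_mod_cast this
  have h1 : j + L + 1 - (j - L) = 2 * L + 1 := by ring
  have h2 : n + L + 1 - (n - L) = 2 * L + 1 := by ring
  simp only [sqΛ, Finset.card_product, Int.card_Icc, h1, h2]
  push_cast [h]
  ring

lemma exists_linear_mul_half_pow_le :
    ∃ α > (0 : ℝ), ∃ N₀ : ℕ, ∀ N ≥ N₀, ∀ t : ℝ, t ≤ 2 * N + 1 →
      4 * (2 * (N : ℝ) + 1) * (1 / 2 : ℝ) ^ N ≤ Real.exp (-α * t) := by
  have hlim : Filter.Tendsto (fun N : ℕ => 12 * ((N : ℝ) * (2 / 3 : ℝ) ^ N)) Filter.atTop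
      (nhds (12 * 0)) := by
    refine Filter.Tendsto.const_mul _ ?_
    simpa using tendsto_pow_const_mul_const_pow_of_abs_lt_one 1
      (r := (2 / 3 : ℝ)) (by rw [abs_of_pos] <;> norm_num)
  have hev := (hlim.eventually_le_const (u := 1) (by norm_num)).and (Filter.eventually_ge_atTop 1)
  obtain ⟨N₀, hN₀⟩ := Filter.eventually_atTop.mp hev
  have hlog : 0 < Real.log (4 / 3) := Real.log_pos (by norm_num)
  refine ⟨Real.log (4 / 3) / 3, by positivity, N₀, fun N hN t ht => ?_⟩
  obtain ⟨hle, h1⟩ := hN₀ N hN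
  have h1' : (1 : ℝ) ≤ N := by exact_mod_cast h1
  calc 4 * (2 * (N : ℝ) + 1) * (1 / 2 : ℝ) ^ N ≤ 12 * N * (1 / 2 : ℝ) ^ N := by
        refine mul_le_mul_of_nonneg_right ?_ (by positivity)
        linarith
    _ = 12 * (N * (2 / 3 : ℝ) ^ N) * (3 / 4 : ℝ) ^ N := by
        rw [show (1 / 2 : ℝ) = 2 / 3 * (3 / 4) by norm_num, mul_pow]
        ring
    _ ≤ 1 * (3 / 4 : ℝ) ^ N := by gcongr
    _ = Real.exp (-(N * Real.log (4 / 3))) := by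
        rw [Real.exp_neg, Real.exp_nat_mul, Real.exp_log (by norm_num), one_mul,
          ← inv_pow]
        norm_num
    _ ≤ _ := by
        apply Real.exp_le_exp.mpr
        nlinarith

/-- normalized eigenfunctions of `H_{Λ_j}` with eigenvalue in
`[−2δ, 2δ]` are exponentially small on the boundary of `Λ_j`. -/
theorem boundary_smallness (δ : ℝ) (hδ0 : 0 < δ) (hδ1 : δ < 1 / 4) :
    ∃ α > (0 : ℝ), ∃ j₀ : ℤ,
      ∀ j n L : ℤ, n + j ^ 2 = 0 → j₀ < |j| → |j| ≤ L → L ≤ 2 * (|j| - 1) →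
        ∀ (φ : (sqΛ j n L) → ℂ) (lam : ℝ),
          (∑ x : (sqΛ j n L), ‖φ x‖ ^ 2) = 1 →
          lam ∈ Set.Icc (-(2 * δ)) (2 * δ) →
          ((Hmat δ (sqΛ j n L)).map ((↑) : ℝ → ℂ)).mulVec φ = (lam : ℂ) • φ →
          Real.sqrt (∑ x ∈ Finset.univ.filter
              (fun x : (sqΛ j n L) => (x : ℤ × ℤ) ∈ bdry j n L), ‖φ x‖ ^ 2) ≤
            Real.exp (-α * |(j : ℝ)|) := by
  obtain ⟨α, hα, N₀, hN₀⟩ := exists_linear_mul_half_pow_le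
  refine ⟨α, hα, max 10 (2 * N₀), fun j n L hP hj hjL hL φ lam hφ hlam h => ?_⟩
  obtain ⟨hj10, hjN⟩ := max_lt_iff.mp hj
  set N : ℕ := j.natAbs / 2 with hN
  have hjabs : |j| = (j.natAbs : ℤ) := Int.abs_eq_natAbs j
  have hsmall : ∀ x, ‖φ x‖ ≤ 1 := fun x => by
    have := Finset.single_le_sum (f := fun x => ‖φ x‖ ^ 2) (fun _ _ => by positivity)
      (Finset.mem_univ x)
    rw [hφ] at this
    exact (sq_le_one_iff₀ (norm_nonneg _)).mp this
  have hdecay := norm_le_half_pow hδ0.le hδ1.le hP hj10.le hL hsmall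
    (abs_le.mpr hlam) h N
  have ht : |(j : ℝ)| ≤ 2 * N + 1 := by
    have : |j| ≤ 2 * (N : ℤ) + 1 := by omega
    exact_mod_cast this
  have hLN : 2 * (L : ℝ) + 1 ≤ 4 * (2 * N + 1) := by
    have : 2 * L + 1 ≤ 4 * (2 * (N : ℤ) + 1) := by omega
    exact_mod_cast this
  have hL0 : (0 : ℝ) ≤ L := by exact_mod_cast (abs_nonneg j).trans hjL
  refine le_trans ?_ (hN₀ N (by omega) _ ht)
  refine Real.sqrt_le_iff.mpr ⟨by positivity, ?_⟩
  calc _ ≤ ∑ x ∈ Finset.univ.filter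
          (fun x : (sqΛ j n L) => (x : ℤ × ℤ) ∈ bdry j n L), ((1 / 2 : ℝ) ^ N) ^ 2 := by
        refine Finset.sum_le_sum fun x hx => ?_
        have := le_supDist_of_mem_bdry (Finset.mem_filter.mp hx).2
        gcongr
        exact hdecay x (by omega)
    _ ≤ ∑ x : sqΛ j n L, ((1 / 2 : ℝ) ^ N) ^ 2 :=
        Finset.sum_le_sum_of_subset_of_nonneg (Finset.filter_subset _ _)
          fun _ _ _ => by positivity
    _ = (2 * L + 1) ^ 2 * ((1 / 2 : ℝ) ^ N) ^ 2 := by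
        rw [Finset.sum_const, nsmul_eq_mul, Finset.card_univ, Fintype.card_coe,
          card_sqΛ j n ((abs_nonneg j).trans hjL)]
    _ ≤ (4 * (2 * N + 1)) ^ 2 * ((1 / 2 : ℝ) ^ N) ^ 2 := by gcongr
    _ = _ := by ring
end
end
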